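/- Let N be a standard Gaussian random variable and let f : ℝ → ℝ be a 1-Lipschitz function. Define g(x) := e^{x²/2}·∫_{−∞}^x (f(y) − E[f(N)])·e^{−y²/2} dy for x ∈ ℝ. Then g is continuously differentiable and satisfies the Stein equation g'(x) − x·g(x) = f(x) − E[f(N)] for all x ∈ ℝ; moreover sup_{x∈ℝ} |g'(x)| ≤ √(2/π) and g' is 2-Lipschitz (i.e. ‖g''‖_∞ ≤ 2 in the a.e. sense). -/

import Mathlib

open MeasureTheory ProbabilityTheory Real Set Filter Topology

/-- The unnormalized standard Gaussian density. -/
noncomputable def gaussWeight (x : ℝ) : ℝ := exp (-(x ^ 2) / 2)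

/-- The unnormalized Gaussian mass of `(-∞, x]`. -/
noncomputable def lowerMass (x : ℝ) : ℝ := ∫ y in Iic x, gaussWeight y

/-- The unnormalized Gaussian mass of `(x, ∞)`. -/
noncomputable def upperMass (x : ℝ) : ℝ := ∫ y in Ioi x, gaussWeight y

theorem gaussWeight_eq (x : ℝ) : gaussWeight x = exp (-(1 / 2) * x ^ 2) := by
  rw [gaussWeight]; congr 1; ring

theorem gaussWeight_pos (x : ℝ) : 0 < gaussWeight x := exp_pos _

theorem gaussWeight_le_one (x : ℝ) : gaussWeight x ≤ 1 :=
  exp_le_one_iff.2 (by nlinarith [sq_nonneg x])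

theorem gaussWeight_neg (x : ℝ) : gaussWeight (-x) = gaussWeight x := by
  simp [gaussWeight]

theorem exp_sq_div_two_mul_gaussWeight (x : ℝ) : exp (x ^ 2 / 2) * gaussWeight x = 1 := by
  rw [gaussWeight, ← exp_add, neg_div, add_neg_cancel, exp_zero]

theorem hasDerivAt_gaussWeight (x : ℝ) : HasDerivAt gaussWeight (-x * gaussWeight x) x := by
  have h : HasDerivAt (fun y : ℝ => -(y ^ 2) / 2) (-x) x := by
    convert! ((hasDerivAt_pow 2 x).neg.div_const 2) using 1
    simp; ring
  convert! h.exp using 1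
  rw [gaussWeight]; ring

theorem continuous_gaussWeight : Continuous gaussWeight :=
  continuous_iff_continuousAt.2 fun x => (hasDerivAt_gaussWeight x).continuousAt

theorem integrable_gaussWeight : Integrable gaussWeight := by
  rw [funext gaussWeight_eq]
  exact integrable_exp_neg_mul_sq (by norm_num)

theorem integrable_mul_gaussWeight : Integrable fun y => y * gaussWeight y := by
  simp_rw [gaussWeight_eq]
  exact integrable_mul_exp_neg_mul_sq (by norm_num)

theorem integral_gaussWeight : ∫ y, gaussWeight y = √(2 * π) := by
  simp_rw [gaussWeight_eq]
  rw [integral_gaussian]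
  congr 1; ring

theorem tendsto_gaussWeight_cocompact : Tendsto gaussWeight (cocompact ℝ) (𝓝 0) := by
  have h := tendsto_rpow_abs_mul_exp_neg_mul_sq_cocompact (a := 1 / 2) (by norm_num) 0
  simpa [funext gaussWeight_eq] using h

theorem tendsto_gaussWeight_atTop : Tendsto gaussWeight atTop (𝓝 0) :=
  tendsto_gaussWeight_cocompact.mono_left atTop_le_cocompact

theorem tendsto_gaussWeight_atBot : Tendsto gaussWeight atBot (𝓝 0) :=
  tendsto_gaussWeight_cocompact.mono_left atBot_le_cocompact

theorem setIntegral_Ioi_mul_gaussWeight (x : ℝ) :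
    ∫ y in Ioi x, y * gaussWeight y = gaussWeight x := by
  have h := integral_Ioi_of_hasDerivAt_of_tendsto' (a := x) (f := fun y => -gaussWeight y)
    (f' := fun y => y * gaussWeight y) (m := 0)
    (fun y _ => by simpa using (hasDerivAt_gaussWeight y).fun_neg)
    integrable_mul_gaussWeight.integrableOn (by simpa using tendsto_gaussWeight_atTop.neg)
  simpa using h

theorem setIntegral_Iic_mul_gaussWeight (x : ℝ) :
    ∫ y in Iic x, y * gaussWeight y = -gaussWeight x := by
  have h := integral_Iic_of_hasDerivAt_of_tendsto' (a := x) (f := fun y => -gaussWeight y)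
    (f' := fun y => y * gaussWeight y) (m := 0)
    (fun y _ => by simpa using (hasDerivAt_gaussWeight y).fun_neg)
    integrable_mul_gaussWeight.integrableOn (by simpa using tendsto_gaussWeight_atBot.neg)
  simpa using h

theorem hasDerivAt_setIntegral_Iic {h : ℝ → ℝ} (hc : Continuous h) (hi : Integrable h) (x : ℝ) :
    HasDerivAt (fun u => ∫ y in Iic u, h y) (h x) x := by
  have key : (fun u => ∫ y in Iic u, h y) =
      fun u => (∫ y in Iic (0 : ℝ), h y) + ∫ y in (0 : ℝ)..u, h y := by
    funext u
    rw [← intervalIntegral.integral_Iic_sub_Iic hi.integrableOn hi.integrableOn]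
    ring
  rw [key]
  exact (hc.integral_hasStrictDerivAt 0 x).hasDerivAt.const_add _

theorem lowerMass_add_upperMass (x : ℝ) : lowerMass x + upperMass x = √(2 * π) := by
  rw [← integral_gaussWeight]
  exact intervalIntegral.integral_Iic_add_Ioi integrable_gaussWeight.integrableOn
    integrable_gaussWeight.integrableOn

theorem lowerMass_neg (x : ℝ) : lowerMass (-x) = upperMass x := by
  have h := integral_comp_neg_Iic (-x) gaussWeight
  simpa [gaussWeight_neg, lowerMass, upperMass] using h

theorem upperMass_neg (x : ℝ) : upperMass (-x) = lowerMass x := by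
  rw [← lowerMass_neg, neg_neg]

theorem hasDerivAt_lowerMass (x : ℝ) : HasDerivAt lowerMass (gaussWeight x) x :=
  hasDerivAt_setIntegral_Iic continuous_gaussWeight integrable_gaussWeight x

theorem upperMass_eq : upperMass = fun x => √(2 * π) - lowerMass x := by
  funext x
  rw [← lowerMass_add_upperMass x]; ring

theorem hasDerivAt_upperMass (x : ℝ) : HasDerivAt upperMass (-gaussWeight x) x := by
  rw [upperMass_eq]
  exact (hasDerivAt_lowerMass x).const_sub _

theorem tendsto_lowerMass_atTop : Tendsto lowerMass atTop (𝓝 √(2 * π)) := by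
  rw [← integral_gaussWeight]
  exact (aecover_Iic tendsto_id).integral_tendsto_of_countably_generated integrable_gaussWeight

theorem tendsto_upperMass_atTop : Tendsto upperMass atTop (𝓝 0) := by
  rw [upperMass_eq]
  simpa using tendsto_lowerMass_atTop.const_sub √(2 * π)

/-- The lower bound in Mills' ratio inequality. -/
theorem mul_gaussWeight_le_mul_upperMass (x : ℝ) :
    x * gaussWeight x ≤ (1 + x ^ 2) * upperMass x := by
  have hd (y : ℝ) : HasDerivAt (fun y => upperMass y - y / (1 + y ^ 2) * gaussWeight y)
      (-(2 / (1 + y ^ 2) ^ 2 * gaussWeight y)) y := by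
    have hy : 1 + y ^ 2 ≠ 0 := by positivity
    have h1 := (hasDerivAt_id y).div ((hasDerivAt_pow 2 y).const_add 1) hy
    convert! (hasDerivAt_upperMass y).sub (h1.mul (hasDerivAt_gaussWeight y)) using 1
    simp
    field_simp
    ring
  have hanti : Antitone fun y => upperMass y - y / (1 + y ^ 2) * gaussWeight y :=
    antitone_of_hasDerivAt_nonpos hd fun y => by
      have := gaussWeight_pos y
      simp only [Pi.zero_apply, Left.neg_nonpos_iff]
      positivity
  have hbdd (y : ℝ) : ‖y / (1 + y ^ 2) * gaussWeight y‖ ≤ gaussWeight y := by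
    rw [norm_mul, norm_of_nonneg (gaussWeight_pos y).le]
    refine mul_le_of_le_one_left (gaussWeight_pos y).le ?_
    rw [norm_eq_abs, abs_div, abs_of_pos (by positivity : 0 < 1 + y ^ 2), div_le_one (by positivity)]
    nlinarith [sq_abs y, sq_nonneg (|y| - 1), abs_nonneg y]
  have hlim : Tendsto (fun y => upperMass y - y / (1 + y ^ 2) * gaussWeight y) atTop (𝓝 0) := by
    simpa using tendsto_upperMass_atTop.sub
      (squeeze_zero_norm hbdd tendsto_gaussWeight_atTop)
  have h := hanti.le_of_tendsto hlim x
  have h1 : (0 : ℝ) < 1 + x ^ 2 := by positivity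
  rw [sub_nonneg, div_mul_eq_mul_div, div_le_iff₀ h1] at h
  linarith

theorem neg_mul_gaussWeight_le_mul_lowerMass (x : ℝ) :
    -(x * gaussWeight x) ≤ (1 + x ^ 2) * lowerMass x := by
  simpa [gaussWeight_neg, upperMass_neg] using mul_gaussWeight_le_mul_upperMass (-x)

theorem lowerMass_zero : lowerMass 0 = √(2 * π) / 2 := by
  have h := lowerMass_neg 0
  rw [neg_zero] at h
  linarith [lowerMass_add_upperMass 0]

theorem gaussWeight_zero : gaussWeight 0 = 1 := by simp [gaussWeight]

theorem lowerMass_sub_upperMass_le {x : ℝ} (hx : 0 ≤ x) :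
    lowerMass x - upperMass x ≤ 2 * x := by
  have hd (y : ℝ) : HasDerivAt (fun y => 2 * y - (lowerMass y - upperMass y))
      (2 - (gaussWeight y - -gaussWeight y)) y := by
    simpa using ((hasDerivAt_id y).const_mul 2).fun_sub
      ((hasDerivAt_lowerMass y).fun_sub (hasDerivAt_upperMass y))
  have hmono : Monotone fun y => 2 * y - (lowerMass y - upperMass y) :=
    monotone_of_hasDerivAt_nonneg hd fun y => by
      have := gaussWeight_le_one y
      simp only [Pi.zero_apply]; linarith
  have h := hmono hx
  simp only at h
  linarith [lowerMass_add_upperMass 0, lowerMass_zero]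

theorem mul_lowerMass_sub_upperMass_add_le {x : ℝ} (hx : 0 ≤ x) :
    x * (lowerMass x - upperMass x) + 2 * gaussWeight x ≤ 2 + x ^ 2 := by
  have hd (y : ℝ) : HasDerivAt
      (fun y => 2 + y ^ 2 - (y * (lowerMass y - upperMass y) + 2 * gaussWeight y))
      (2 * y - (lowerMass y - upperMass y)) y := by
    convert! ((hasDerivAt_pow 2 y).const_add 2).sub (((hasDerivAt_id y).mul
      ((hasDerivAt_lowerMass y).sub (hasDerivAt_upperMass y))).add
      ((hasDerivAt_gaussWeight y).const_mul 2)) using 1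
    simp; ring
  have hmono : MonotoneOn
      (fun y => 2 + y ^ 2 - (y * (lowerMass y - upperMass y) + 2 * gaussWeight y)) (Ici 0) :=
    monotoneOn_of_deriv_nonneg (convex_Ici 0) (fun y _ => (hd y).continuousAt.continuousWithinAt)
      (fun y _ => (hd y).differentiableAt.differentiableWithinAt) fun y hy => by
        rw [(hd y).deriv]
        linarith [lowerMass_sub_upperMass_le (interior_subset hy : y ∈ Ici (0 : ℝ))]
  have h := hmono self_mem_Ici hx hx
  simp only [gaussWeight_zero] at h
  linarith

theorem partialMoments_mul_le_of_pos {x : ℝ} (hx : 0 < x) :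
    (gaussWeight x + x * lowerMass x) * (gaussWeight x - x * upperMass x) ≤ gaussWeight x := by
  let T : ℝ → ℝ := fun y => lowerMass y * upperMass y -
    gaussWeight y * ((gaussWeight y - 1) * (y⁻¹ * y⁻¹) + (lowerMass y - upperMass y) * y⁻¹)
  have hd {y : ℝ} (hy : 0 < y) : HasDerivAt T (-(gaussWeight y * (2 + y ^ 2 -
      (y * (lowerMass y - upperMass y) + 2 * gaussWeight y)) / y ^ 3)) y := by
    have hI := hasDerivAt_lowerMass y
    have hJ := hasDerivAt_upperMass y
    have hw := hasDerivAt_gaussWeight y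
    have hinv := hasDerivAt_inv hy.ne'
    convert! (hI.mul hJ).sub (hw.mul (((hw.sub_const 1).mul (hinv.mul hinv)).add
      ((hI.sub hJ).mul hinv))) using 1
    simp
    field_simp
    ring
  have hanti : AntitoneOn T (Ioi 0) :=
    antitoneOn_of_deriv_nonpos (convex_Ioi 0)
      (fun y hy => (hd hy).continuousAt.continuousWithinAt)
      (fun y hy => (hd (interior_subset hy)).differentiableAt.differentiableWithinAt)
      fun y hy => by
        have hy : 0 < y := interior_subset hy
        rw [(hd hy).deriv, Left.neg_nonpos_iff]
        have := mul_lowerMass_sub_upperMass_add_le hy.le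
        exact div_nonneg (mul_nonneg (gaussWeight_pos y).le (by linarith)) (by positivity)
  have hlim : Tendsto T atTop (𝓝 0) := by
    have hI := tendsto_lowerMass_atTop
    have hJ := tendsto_upperMass_atTop
    have hw := tendsto_gaussWeight_atTop
    have hinv : Tendsto (fun y : ℝ => y⁻¹) atTop (𝓝 0) := tendsto_inv_atTop_zero
    simpa using (hI.mul hJ).sub (hw.mul (((hw.sub_const 1).mul (hinv.mul hinv)).add
      ((hI.sub hJ).mul hinv)))
  have h : 0 ≤ T x := le_of_tendsto hlim <| (eventually_ge_atTop x).mono fun y hy =>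
    hanti hx (hx.trans_le hy) hy
  have h2 : T x * x ^ 2 = lowerMass x * upperMass x * x ^ 2 - gaussWeight x *
      ((gaussWeight x - 1) + (lowerMass x - upperMass x) * x) := by
    simp only [T]
    field_simp
  have h3 := mul_nonneg h (sq_nonneg x)
  rw [h2] at h3
  linarith

theorem partialMoments_mul_le (x : ℝ) :
    (gaussWeight x + x * lowerMass x) * (gaussWeight x - x * upperMass x) ≤ gaussWeight x := by
  rcases lt_trichotomy x 0 with hx | rfl | hx
  · have h := partialMoments_mul_le_of_pos (neg_pos.2 hx)
    simp only [gaussWeight_neg, lowerMass_neg, upperMass_neg] at h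
    linarith
  · simp [gaussWeight_zero]
  · exact partialMoments_mul_le_of_pos hx

section Lipschitz

variable {f : ℝ → ℝ}

theorem LipschitzWith.integrable_apply_mul_gaussWeight (hf : LipschitzWith 1 f) :
    Integrable fun y => f y * gaussWeight y := by
  refine ((integrable_gaussWeight.const_mul |f 0|).add integrable_mul_gaussWeight.norm).mono'
    (hf.continuous.mul continuous_gaussWeight).aestronglyMeasurable (.of_forall fun y => ?_)
  have h : |f y - f 0| ≤ |y| := by simpa [dist_eq] using hf.dist_le_mul y 0
  have h2 : |f y| ≤ |f 0| + |y| := by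
    linarith [abs_sub_abs_le_abs_sub (f y) (f 0)]
  have hw := gaussWeight_pos y
  simp only [Pi.add_apply, norm_mul, norm_eq_abs, abs_of_pos hw]
  nlinarith

theorem LipschitzWith.integrable_apply_sub_mul_gaussWeight (hf : LipschitzWith 1 f) (c : ℝ) :
    Integrable fun y => (f y - c) * gaussWeight y := by
  simp_rw [sub_mul]
  exact hf.integrable_apply_mul_gaussWeight.sub (integrable_gaussWeight.const_mul c)

theorem LipschitzWith.abs_setIntegral_Iic_le (hf : LipschitzWith 1 f) (x : ℝ) :
    |∫ y in Iic x, (f y - f x) * gaussWeight y| ≤ gaussWeight x + x * lowerMass x := by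
  have hle : ∀ᵐ y ∂volume.restrict (Iic x),
      ‖(f y - f x) * gaussWeight y‖ ≤ x * gaussWeight y - y * gaussWeight y := by
    filter_upwards [ae_restrict_mem measurableSet_Iic] with y hy
    have h : |f y - f x| ≤ |y - x| := by simpa [dist_eq] using hf.dist_le_mul y x
    rw [abs_of_nonpos (sub_nonpos.2 (mem_Iic.1 hy))] at h
    rw [norm_mul, norm_of_nonneg (gaussWeight_pos y).le, norm_eq_abs]
    nlinarith [gaussWeight_pos y]
  have hint := integrable_gaussWeight.const_mul x
  refine (norm_integral_le_of_norm_le (hint.sub integrable_mul_gaussWeight).integrableOn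
    hle).trans_eq ?_
  rw [integral_sub' hint.integrableOn integrable_mul_gaussWeight.integrableOn,
    integral_const_mul, setIntegral_Iic_mul_gaussWeight, lowerMass]
  ring

theorem LipschitzWith.abs_setIntegral_Ioi_le (hf : LipschitzWith 1 f) (x : ℝ) :
    |∫ y in Ioi x, (f y - f x) * gaussWeight y| ≤ gaussWeight x - x * upperMass x := by
  have hle : ∀ᵐ y ∂volume.restrict (Ioi x),
      ‖(f y - f x) * gaussWeight y‖ ≤ y * gaussWeight y - x * gaussWeight y := by
    filter_upwards [ae_restrict_mem measurableSet_Ioi] with y hy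
    have h : |f y - f x| ≤ |y - x| := by simpa [dist_eq] using hf.dist_le_mul y x
    rw [abs_of_pos (sub_pos.2 (mem_Ioi.1 hy))] at h
    rw [norm_mul, norm_of_nonneg (gaussWeight_pos y).le, norm_eq_abs]
    nlinarith [gaussWeight_pos y]
  have hint := integrable_gaussWeight.const_mul x
  refine (norm_integral_le_of_norm_le (integrable_mul_gaussWeight.sub hint).integrableOn
    hle).trans_eq ?_
  rw [integral_sub' integrable_mul_gaussWeight.integrableOn hint.integrableOn,
    integral_const_mul, setIntegral_Ioi_mul_gaussWeight, upperMass]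

end Lipschitz

theorem mul_upperMass_le_gaussWeight (x : ℝ) : x * upperMass x ≤ gaussWeight x :=
  sub_nonneg.1 <| (abs_nonneg _).trans ((LipschitzWith.id (α := ℝ)).abs_setIntegral_Ioi_le x)

theorem gaussWeight_add_mul_lowerMass_nonneg (x : ℝ) : 0 ≤ gaussWeight x + x * lowerMass x :=
  (abs_nonneg _).trans ((LipschitzWith.id (α := ℝ)).abs_setIntegral_Iic_le x)

theorem sqrt_two_mul_pi_mul_integral_gaussianReal (f : ℝ → ℝ) :
    √(2 * π) * ∫ y, f y ∂(gaussianReal 0 1) = ∫ y, f y * gaussWeight y := by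
  rw [integral_gaussianReal_eq_integral_smul one_ne_zero, ← integral_const_mul]
  refine integral_congr_ae (.of_forall fun y => ?_)
  have : √(2 * π) ≠ 0 := by positivity
  simp [gaussianPDFReal_def, gaussWeight]
  field_simp

/-- **Properties of the solution of the one-dimensional Stein equation.**
Let `N` be standard Gaussian and `f : ℝ → ℝ` be `1`-Lipschitz.  With
`c := E[f(N)]` and `g(x) := e^{x²/2}·∫_{−∞}^x (f(y) − c)·e^{−y²/2} dy`,
the function `g` is continuously differentiable, solves the Stein equation
`g'(x) − x·g(x) = f(x) − c` for all `x`, satisfies `‖g'‖_∞ ≤ √(2/π)`,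
and `g'` is `2`-Lipschitz (so that `‖g''‖_∞ ≤ 2` a.e.). -/
theorem stein_equation_univariate_solution_properties
    (f : ℝ → ℝ) (hf : LipschitzWith 1 f)
    (c : ℝ) (hc : c = ∫ y, f y ∂(gaussianReal 0 1))
    (g : ℝ → ℝ)
    (hg : g = fun x : ℝ =>
      Real.exp (x ^ 2 / 2) * ∫ y in Set.Iic x, (f y - c) * Real.exp (-(y ^ 2) / 2)) :
    ContDiff ℝ 1 g ∧
    (∀ x : ℝ, deriv g x - x * g x = f x - c) ∧
    (∀ x : ℝ, |deriv g x| ≤ Real.sqrt (2 / π)) ∧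
    LipschitzWith 2 (deriv g) := by
  have hZ : 0 < √(2 * π) := by positivity
  have hfc := hf.integrable_apply_sub_mul_gaussWeight c
  have hg' : g = fun x => exp (x ^ 2 / 2) * ∫ y in Iic x, (f y - c) * gaussWeight y := hg
  have hgw (x : ℝ) : g x * gaussWeight x = ∫ y in Iic x, (f y - c) * gaussWeight y := by
    rw [hg']
    linear_combination (∫ y in Iic x, (f y - c) * gaussWeight y) *
      exp_sq_div_two_mul_gaussWeight x
  have hsplit (x : ℝ) : ∫ y in Iic x, (f y - c) * gaussWeight y =
      (∫ y in Iic x, (f y - f x) * gaussWeight y) + (f x - c) * lowerMass x := by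
    rw [lowerMass, ← integral_const_mul, ← integral_add
      (hf.integrable_apply_sub_mul_gaussWeight (f x)).integrableOn
      (integrable_gaussWeight.const_mul _).integrableOn]
    congr 1; funext y; ring
  have hcenter (x : ℝ) : √(2 * π) * (c - f x) = (∫ y in Iic x, (f y - f x) * gaussWeight y) +
      ∫ y in Ioi x, (f y - f x) * gaussWeight y := by
    have hi := hf.integrable_apply_sub_mul_gaussWeight (f x)
    rw [intervalIntegral.integral_Iic_add_Ioi hi.integrableOn hi.integrableOn, mul_sub, hc,
      sqrt_two_mul_pi_mul_integral_gaussianReal]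
    simp_rw [sub_mul]
    rw [integral_sub hf.integrable_apply_mul_gaussWeight (integrable_gaussWeight.const_mul _),
      integral_const_mul, integral_gaussWeight, mul_comm]
  have hderiv (x : ℝ) : HasDerivAt g (x * g x + (f x - c)) x := by
    have h1 : HasDerivAt (fun y : ℝ => y ^ 2 / 2) x x := by
      convert! (hasDerivAt_pow 2 x).div_const 2 using 1
      simp
    have h2 := h1.exp.mul (hasDerivAt_setIntegral_Iic (h := fun y => (f y - c) * gaussWeight y)
      ((hf.continuous.sub continuous_const).mul continuous_gaussWeight) hfc x)
    rw [hg']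
    convert! h2 using 1
    linear_combination (c - f x) * exp_sq_div_two_mul_gaussWeight x
  have hdg : deriv g = fun x => x * g x + (f x - c) := funext fun x => (hderiv x).deriv
  have hdiff : Differentiable ℝ g := fun x => (hderiv x).differentiableAt
  refine ⟨contDiff_one_iff_deriv.2 ⟨hdiff, ?_⟩, fun x => by rw [hdg]; ring, fun x => ?_, ?_⟩
  · rw [hdg]
    exact (continuous_id.mul hdiff.continuous).add (hf.continuous.sub continuous_const)
  · have hsqrt : √(2 / π) * √(2 * π) = 2 := by
      rw [← sqrt_mul (by positivity), show 2 / π * (2 * π) = 2 ^ 2 by field_simp]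
      exact sqrt_sq zero_le_two
    have hw := gaussWeight_pos x
    have hL := hf.abs_setIntegral_Iic_le x
    have hR := hf.abs_setIntegral_Ioi_le x
    have hu := gaussWeight_add_mul_lowerMass_nonneg x
    have hv := sub_nonneg.2 (mul_upperMass_le_gaussWeight x)
    have hs := (hgw x).trans (hsplit x)
    have hc' := hcenter x
    have hIJ := lowerMass_add_upperMass x
    have hK := partialMoments_mul_le x
    rw [hdg]
    generalize (∫ y in Iic x, (f y - f x) * gaussWeight y) = L at *
    generalize (∫ y in Ioi x, (f y - f x) * gaussWeight y) = R at *
    have hkey : (x * g x + (f x - c)) * (√(2 * π) * gaussWeight x) =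
        -(L * (gaussWeight x - x * upperMass x) + R * (gaussWeight x + x * lowerMass x)) := by
      linear_combination x * √(2 * π) * hs - (x * lowerMass x + gaussWeight x) * hc' - x * L * hIJ
    refine le_of_mul_le_mul_right ?_ (mul_pos hZ hw)
    rw [← abs_of_pos (mul_pos hZ hw), ← abs_mul, hkey, abs_neg, abs_of_pos (mul_pos hZ hw),
      ← mul_assoc, hsqrt]
    refine (abs_add_le _ _).trans ?_
    rw [abs_mul, abs_mul, abs_of_nonneg hu, abs_of_nonneg hv]
    nlinarith [mul_le_mul_of_nonneg_right hL hv, mul_le_mul_of_nonneg_right hR hu]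
  · have hlip : LipschitzWith 1 fun x => x * g x - c := by
      have hd (x : ℝ) : HasDerivAt (fun x => x * g x - c)
          (g x + x * (x * g x + (f x - c))) x := by
        simpa using ((hasDerivAt_id x).fun_mul (hderiv x)).sub_const c
      refine lipschitzWith_of_nnnorm_deriv_le (𝕜 := ℝ) (fun x => (hd x).differentiableAt)
        fun x => ?_
      rw [(hd x).deriv, ← NNReal.coe_le_coe, coe_nnnorm, norm_eq_abs, NNReal.coe_one]
      have hw := gaussWeight_pos x
      have hL := hf.abs_setIntegral_Iic_le x
      have hR := hf.abs_setIntegral_Ioi_le x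
      have hP := sub_nonneg.2 (mul_gaussWeight_le_mul_upperMass x)
      have hQ : 0 ≤ (1 + x ^ 2) * lowerMass x + x * gaussWeight x := by
        linarith [neg_mul_gaussWeight_le_mul_lowerMass x]
      have hs := (hgw x).trans (hsplit x)
      have hc' := hcenter x
      have hIJ := lowerMass_add_upperMass x
      generalize (∫ y in Iic x, (f y - f x) * gaussWeight y) = L at *
      generalize (∫ y in Ioi x, (f y - f x) * gaussWeight y) = R at *
      have hkey : (g x + x * (x * g x + (f x - c))) * (√(2 * π) * gaussWeight x) =
          L * ((1 + x ^ 2) * upperMass x - x * gaussWeight x) -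
            R * ((1 + x ^ 2) * lowerMass x + x * gaussWeight x) := by
        linear_combination (1 + x ^ 2) * √(2 * π) * hs -
          ((1 + x ^ 2) * lowerMass x + x * gaussWeight x) * hc' - (1 + x ^ 2) * L * hIJ
      refine le_of_mul_le_mul_right ?_ (mul_pos hZ hw)
      rw [← abs_of_pos (mul_pos hZ hw), ← abs_mul, hkey, abs_of_pos (mul_pos hZ hw), one_mul]
      refine (abs_sub _ _).trans ?_
      rw [abs_mul, abs_mul, abs_of_nonneg hP, abs_of_nonneg hQ]
      calc _ ≤ _ := add_le_add (mul_le_mul_of_nonneg_right hL hP)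
            (mul_le_mul_of_nonneg_right hR hQ)
        _ = √(2 * π) * gaussWeight x := by rw [← hIJ]; ring
    have hsum := hlip.add hf
    rw [one_add_one_eq_two] at hsum
    rw [hdg]
    convert! hsum using 2
    ring
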